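/- If a Banach space X is reflexive and has a Schauder basis, and Y is any Banach space such that the quotient criterion of Godefroy–Saphar applies (namely L_K(X;Y)^⊥ is complemented in L(X;Y)' and L_K(X;Y) has the approximation property), then: if L(X;Y)/L_K(X;Y) has the approximation property, so does L(X;Y). -/

import Mathlib

open scoped ENNReal

noncomputable section

/-- A normed space `E` has the approximation property if for every compact set `K` and `ε > 0`
there is a finite rank bounded operator `T : E → E` with `‖T x - x‖ < ε` on `K`. -/
def HasAP (𝕜 E : Type*) [NontriviallyNormedField 𝕜] [SeminormedAddCommGroup E]
    [NormedSpace 𝕜 E] : Prop :=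
  ∀ K : Set E, IsCompact K → ∀ ε : ℝ, 0 < ε →
    ∃ T : E →L[𝕜] E, FiniteDimensional 𝕜 (LinearMap.range (T : E →ₗ[𝕜] E)) ∧
      ∀ x ∈ K, ‖T x - x‖ < ε

/-- `X` has a Schauder basis: a biorthogonal system whose partial-sum expansions converge to
every vector. -/
def HasSchauderBasis (𝕜 X : Type*) [RCLike 𝕜] [NormedAddCommGroup X] [NormedSpace 𝕜 X] : Prop :=
  ∃ (e : ℕ → X) (f : ℕ → X →L[𝕜] 𝕜),
    (∀ i j, f i (e j) = if i = j then 1 else 0) ∧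
    ∀ x : X, Filter.Tendsto (fun N => ∑ i ∈ Finset.range N, f i x • e i)
      Filter.atTop (nhds x)

/-- The annihilator `L_K(X;Y)^⊥` of the compact operators inside the dual of `L(X;Y)`. -/
def annihilatorOfCompacts (𝕜 X Y : Type*) [RCLike 𝕜] [NormedAddCommGroup X] [NormedSpace 𝕜 X]
    [NormedAddCommGroup Y] [NormedSpace 𝕜 Y] :
    Submodule 𝕜 ((X →L[𝕜] Y) →L[𝕜] 𝕜) where
  carrier := {φ | ∀ T ∈ compactOperator (RingHom.id 𝕜) X Y, φ T = 0}
  add_mem' := by intro a b ha hb T hT; simp [ha T hT, hb T hT]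
  zero_mem' := by intro T hT; simp
  smul_mem' := by intro c a ha T hT; simp [ha T hT]

open Filter Topology

lemma gs_lift {𝕜 E : Type*} [RCLike 𝕜] [NormedAddCommGroup E] [NormedSpace 𝕜 E]
    (M : Submodule 𝕜 E) (hM : IsClosed (M : Set E))
    (S : (E ⧸ M) →L[𝕜] (E ⧸ M)) (hS : FiniteDimensional 𝕜 (LinearMap.range (S : (E ⧸ M) →ₗ[𝕜] (E ⧸ M)))) :
    ∃ L : E →L[𝕜] E, FiniteDimensional 𝕜 (LinearMap.range (L : E →ₗ[𝕜] E)) ∧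
      ∀ x, M.mkQ (L x) = S (M.mkQ x) := by
  obtain ⟨g, hg⟩ := M.mkQ.exists_rightInverse_of_surjective M.range_mkQ
  have : IsClosed (M : Set E) := hM
  let W := LinearMap.range (S : (E ⧸ M) →ₗ[𝕜] (E ⧸ M))
  let g' : W →ₗ[𝕜] E := g.comp W.subtype
  have hg' : Continuous g' := g'.continuous_of_finiteDimensional
  have hq : Continuous M.mkQ := continuous_quot_mk
  let Q : E →L[𝕜] (E ⧸ M) := ⟨M.mkQ, hq⟩
  let S' : (E ⧸ M) →L[𝕜] W := S.codRestrict W (fun x => LinearMap.mem_range_self _ x)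
  refine ⟨(⟨g', hg'⟩ : W →L[𝕜] E).comp (S'.comp Q), ?_, ?_⟩
  · have : LinearMap.range (((⟨g', hg'⟩ : W →L[𝕜] E).comp (S'.comp Q) : E →L[𝕜] E) : E →ₗ[𝕜] E)
        ≤ LinearMap.range g' := by
      rintro _ ⟨x, rfl⟩
      exact ⟨S' (Q x), rfl⟩
    exact Submodule.finiteDimensional_of_le this
  · intro x
    exact LinearMap.congr_fun hg (S (M.mkQ x))

lemma gs_abstract {𝕜 E : Type*} [RCLike 𝕜] [NormedAddCommGroup E] [NormedSpace 𝕜 E]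
    (M : Submodule 𝕜 E) (hM : IsClosed (M : Set E)) (R : ℕ → E →L[𝕜] M) (C : ℝ) (hC : 0 ≤ C)
    (hR : ∀ n x, ‖R n x‖ ≤ C * ‖x‖)
    (hlim : ∀ m : M, Tendsto (fun n => ‖(m : E) - R n m‖) atTop (𝓝 0))
    (h1 : HasAP 𝕜 M) (h2 : HasAP 𝕜 (E ⧸ M)) : HasAP 𝕜 E := by
  intro K hK ε hε
  set δ := ε / (2 * C + 5) with hδ
  have hδ0 : 0 < δ := by positivity
  have hq : Continuous M.mkQ := continuous_quot_mk
  obtain ⟨S, hS, hSK⟩ := h2 (M.mkQ '' K) (hK.image hq) δ hδ0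
  obtain ⟨L, hL, hLS⟩ := gs_lift M hM S hS
  have hK' : IsCompact ((fun x => x - L x) '' K) := hK.image (by fun_prop)
  obtain ⟨t, htK, htf, htc⟩ := hK'.finite_cover_balls hδ0
  have hm : ∀ y ∈ t, ∃ m : M, ‖y - m‖ < δ := by
    intro y hy
    obtain ⟨x, hx, rfl⟩ := htK hy
    have h := hSK _ ⟨x, hx, rfl⟩
    rw [← hLS, ← map_sub] at h
    obtain ⟨v, hv, hvn⟩ := (QuotientAddGroup.norm_lt_iff (S := M.toAddSubgroup)).1 h
    have : v - (L x - x) ∈ M := by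
      rw [← Submodule.Quotient.mk_eq_zero, Submodule.Quotient.mk_sub, sub_eq_zero]
      exact hv
    refine ⟨⟨_, this⟩, ?_⟩
    have : x - L x - (v - (L x - x)) = -v := by abel
    simpa only [this, norm_neg] using hvn
  choose! m hm using hm
  have hn : ∀ᶠ n in atTop, ∀ y ∈ t, ‖(m y : E) - R n (m y)‖ < δ :=
    (htf.eventually_all).2 fun y _ => (hlim (m y)).eventually_lt_const hδ0
  obtain ⟨n, hn⟩ := hn.exists
  obtain ⟨T, hT, hTK⟩ := h1 (R n '' K) (hK.image (R n).continuous) δ hδ0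
  have key : ∀ x ∈ K, ‖(x - L x) - R n (x - L x)‖ < (2 * C + 3) * δ := by
    intro x hx
    obtain ⟨y, hy, hxy⟩ := Set.mem_iUnion₂.1 (htc ⟨x, hx, rfl⟩)
    rw [Metric.mem_ball, dist_eq_norm] at hxy
    have e : (x - L x) - R n (x - L x) = ((x - L x - y) + (y - m y)) + (m y - R n (m y))
        - ((R n (x - L x - y) : E) + R n (y - m y)) := by
      simp only [map_sub, Submodule.coe_sub]; abel
    have a1 : ‖(R n (x - L x - y) : E)‖ ≤ C * δ :=
      (hR n _).trans (mul_le_mul_of_nonneg_left hxy.le hC)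
    have a2 : ‖(R n (y - m y) : E)‖ ≤ C * δ :=
      (hR n _).trans (mul_le_mul_of_nonneg_left (hm y hy).le hC)
    rw [e]
    have b1 := norm_sub_le (((x - L x - y) + (y - m y)) + (m y - R n (m y)))
       ((R n (x - L x - y) : E) + R n (y - m y))
    have b2 := norm_add₃_le (a := x - L x - y) (b := y - m y) (c := (m y : E) - R n (m y))
    have b3 := norm_add_le (R n (x - L x - y) : E) (R n (y - m y))
    have := hm y hy
    have := hn y hy
    linarith
  let A : E →L[𝕜] E := L - (M.subtypeL.comp (R n)).comp L
  let B : E →L[𝕜] E := M.subtypeL.comp (T.comp (R n))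
  refine ⟨A + B, ?_, ?_⟩
  · have : LinearMap.range ((A + B : E →L[𝕜] E) : E →ₗ[𝕜] E) ≤
      (LinearMap.range (L : E →ₗ[𝕜] E)).map
        (LinearMap.id - ((M.subtypeL.comp (R n) : E →L[𝕜] E) : E →ₗ[𝕜] E)) ⊔
      (LinearMap.range (T : M →ₗ[𝕜] M)).map M.subtype := by
      rintro _ ⟨x, rfl⟩
      exact Submodule.add_mem_sup ⟨L x, ⟨x, rfl⟩, rfl⟩ ⟨T (R n x), ⟨R n x, rfl⟩, rfl⟩
    exact Submodule.finiteDimensional_of_le this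
  · intro x hx
    have e : (A + B) x - x = ((T (R n x) - R n x : M) : E) - ((x - L x) - R n (x - L x)) := by
      simp [A, B]; abel
    rw [e]
    have h3 : ‖((T (R n x) - R n x : M) : E)‖ < δ := hTK _ ⟨x, hx, rfl⟩
    have h4 := key x hx
    have h5 := norm_sub_le ((T (R n x) - R n x : M) : E) ((x - L x) - R n (x - L x))
    have h6 : ε = (2 * C + 5) * δ := by rw [hδ]; field_simp
    linarith
lemma gs_compact {𝕜 X Y : Type*} [RCLike 𝕜]
    [NormedAddCommGroup X] [NormedSpace 𝕜 X] [NormedAddCommGroup Y] [NormedSpace 𝕜 Y]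
    (hrefl : Function.Bijective (NormedSpace.inclusionInDoubleDual 𝕜 X))
    (f : ℕ → X →L[𝕜] 𝕜) (hf : ∀ x, (∀ i, f i x = 0) → x = 0)
    (P : ℕ → X →L[𝕜] X) (C : ℝ) (hP : ∀ n, ‖P n‖ ≤ C)
    (hfP : ∀ i n, i < n → ∀ x, f i (P n x) = f i x)
    (T : X →L[𝕜] Y) (hT : IsCompactOperator T) :
    Tendsto (fun n => ‖T - T.comp (P n)‖) atTop (𝓝 0) := by
  by_contra hcon
  have : ∃ δ > 0, ∃ᶠ n in atTop, δ ≤ ‖T - T.comp (P n)‖ := by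
    by_contra! h
    apply hcon
    rw [Metric.tendsto_nhds]
    intro ε hε
    filter_upwards [h ε hε] with n hn
    simpa using hn
  obtain ⟨δ, hδ, hfr⟩ := this
  have hx : ∀ n, ∃ x : X, ‖x‖ ≤ 1 ∧ ‖T - T.comp (P n)‖ / 2 ≤ ‖(T - T.comp (P n)) x‖ := by
    intro n
    rcases eq_or_lt_of_le (norm_nonneg (T - T.comp (P n))) with h | h
    · exact ⟨0, by simp, by rw [← h]; simp⟩
    · obtain ⟨x, hx, hx'⟩ := (T - T.comp (P n)).exists_lt_apply_of_lt_opNorm (half_lt_self h)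
      exact ⟨x, hx.le, hx'.le⟩
  choose x hx1 hx2 using hx
  let y : ℕ → X := fun n => x n - P n (x n)
  have hy : ∀ n, ‖y n‖ ≤ 1 + C := by
    intro n
    have h1 := norm_sub_le (x n) (P n (x n))
    have h2 := (P n).le_of_opNorm_le_of_le (hP n) (hx1 n)
    have := hx1 n
    simp only [y]; linarith
  have hTy : ∀ n, ‖T - T.comp (P n)‖ / 2 ≤ ‖T (y n)‖ := by
    intro n; simpa [y] using hx2 n
  have : NeBot (atTop ⊓ 𝓟 {n | δ ≤ ‖T - T.comp (P n)‖}) := frequently_mem_iff_neBot.1 hfr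
  let U := Ultrafilter.of (atTop ⊓ 𝓟 {n | δ ≤ ‖T - T.comp (P n)‖})
  have hU : (U : Filter ℕ) ≤ _ := Ultrafilter.of_le _
  have hU1 : (U : Filter ℕ) ≤ atTop := hU.trans inf_le_left
  have hU2 : ∀ᶠ n in (U : Filter ℕ), δ ≤ ‖T - T.comp (P n)‖ :=
    le_principal_iff.1 (hU.trans inf_le_right)
  -- norm limit of `T (y n)`
  have hcomp := IsCompactOperator.isCompact_closure_image_closedBall (𝕜₁ := 𝕜)
    (f := (T : X →ₗ[𝕜] Y)) hT (1 + C)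
  obtain ⟨z, -, hz⟩ := hcomp.ultrafilter_le_nhds (U.map (fun n => T (y n))) (by
    rw [le_principal_iff]
    exact Eventually.of_forall (f := (U : Filter ℕ)) fun n => subset_closure
      ⟨y n, by simpa using hy n, rfl⟩)
  have hz : Tendsto (fun n => T (y n)) U (𝓝 z) := hz
  -- weak limit of `y n`
  let J := NormedSpace.inclusionInDoubleDual 𝕜 X
  obtain ⟨Φ, -, hΦ⟩ := (WeakDual.isCompact_closedBall (𝕜 := 𝕜) (E := StrongDual 𝕜 X) 0
    (1 + C)).ultrafilter_le_nhds (U.map (fun n => StrongDual.toWeakDual (J (y n)))) (by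
    rw [le_principal_iff]
    refine Eventually.of_forall (f := (U : Filter ℕ)) fun n => ?_
    have : ‖J (y n)‖ ≤ 1 + C := (NormedSpace.double_dual_bound 𝕜 X (y n)).trans (hy n)
    simpa using this)
  have hΦ : Tendsto (fun n => StrongDual.toWeakDual (J (y n))) U (𝓝 Φ) := hΦ
  obtain ⟨w, hw⟩ := hrefl.2 (WeakDual.toStrongDual Φ)
  have hweak : ∀ g : StrongDual 𝕜 X, Tendsto (fun n => g (y n)) U (𝓝 (g w)) := by
    intro g
    have h := ((WeakDual.eval_continuous g).tendsto Φ).comp hΦ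
    have e : Φ g = g w := by
      have := congrArg (fun ψ => ψ g) hw
      exact this.symm
    rw [e] at h
    exact h
  have hw0 : w = 0 := by
    apply hf
    intro i
    refine tendsto_nhds_unique (hweak (f i)) ?_
    refine tendsto_const_nhds.congr' ?_
    filter_upwards [hU1 (eventually_gt_atTop i)] with n hn
    simp [y, hfP i n hn]
  have hz0 : z = 0 := by
    by_contra hne
    obtain ⟨g, -, hg⟩ := exists_dual_vector 𝕜 z (norm_ne_zero_iff.2 hne)
    have h1 := hweak (g.comp T)
    have h2 := (g.continuous.tendsto z).comp hz
    have h3 : g z = g (T w) := tendsto_nhds_unique h2 h1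
    rw [hw0, map_zero, map_zero, hg] at h3
    exact hne (by simpa using h3)
  have hn : Tendsto (fun n => ‖T (y n)‖) U (𝓝 0) := by
    have := hz.norm
    rwa [hz0, norm_zero] at this
  have : δ / 2 ≤ 0 := ge_of_tendsto hn (by
    filter_upwards [hU2] with n hn
    have := hTy n
    linarith)
  linarith

/-- The Godefroy–Saphar principle: if `X` is reflexive with a Schauder basis,
`L_K(X;Y)^⊥` is complemented in `L(X;Y)'` and `L_K(X;Y)` has the approximation property, then
the approximation property of `L(X;Y)/L_K(X;Y)` implies that of `L(X;Y)`. -/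
theorem godefroy_saphar (𝕜 X Y : Type*) [RCLike 𝕜]
    [NormedAddCommGroup X] [NormedSpace 𝕜 X] [CompleteSpace X]
    [NormedAddCommGroup Y] [NormedSpace 𝕜 Y] [CompleteSpace Y]
    (hrefl : Function.Bijective (NormedSpace.inclusionInDoubleDual 𝕜 X))
    (hbasis : HasSchauderBasis 𝕜 X)
    (hann : ∃ π : ((X →L[𝕜] Y) →L[𝕜] 𝕜) →L[𝕜] ((X →L[𝕜] Y) →L[𝕜] 𝕜),
      π.comp π = π ∧ LinearMap.range (π : ((X →L[𝕜] Y) →L[𝕜] 𝕜) →ₗ[𝕜] ((X →L[𝕜] Y) →L[𝕜] 𝕜))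
        = annihilatorOfCompacts 𝕜 X Y)
    (hK : HasAP 𝕜 ↥(compactOperator (RingHom.id 𝕜) X Y))
    (hquot : HasAP 𝕜 ((X →L[𝕜] Y) ⧸ compactOperator (RingHom.id 𝕜) X Y)) :
    HasAP 𝕜 (X →L[𝕜] Y) := by
  obtain ⟨e, f, hef, hconv⟩ := hbasis
  let P : ℕ → X →L[𝕜] X := fun N => ∑ i ∈ Finset.range N, (f i).smulRight (e i)
  have hPx : ∀ N x, P N x = ∑ i ∈ Finset.range N, f i x • e i := by
    intro N x; simp [P]
  obtain ⟨C, hC⟩ : ∃ C, ∀ n, ‖P n‖ ≤ C := by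
    apply banach_steinhaus
    intro x
    have h := hconv x
    simp only [← hPx] at h
    obtain ⟨c, hc⟩ := h.norm.bddAbove_range
    exact ⟨c, fun n => hc ⟨n, rfl⟩⟩
  have hC0 : 0 ≤ C := (norm_nonneg _).trans (hC 0)
  have hf : ∀ x, (∀ i, f i x = 0) → x = 0 := by
    intro x hx
    refine tendsto_nhds_unique (hconv x) ?_
    simp [hx]
  have hfP : ∀ i n, i < n → ∀ x, f i (P n x) = f i x := by
    intro i n hin x
    simp [hPx, hef, hin]
  have hPc : ∀ n, IsCompactOperator (P n) := by
    intro n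
    have : P n ∈ compactOperator (RingHom.id 𝕜) X X := by
      refine Submodule.sum_mem _ fun i _ => ?_
      have h := (isCompactOperator_of_locallyCompactSpace_rng
        (ContinuousLinearMap.toSpanSingleton 𝕜 (e i))).comp_clm (f i)
      exact h
    exact this
  let M := compactOperator (RingHom.id 𝕜) X Y
  let R : ℕ → (X →L[𝕜] Y) →L[𝕜] M := fun n =>
    (ContinuousLinearMap.precomp Y (P n)).codRestrict M (fun T => (hPc n).clm_comp T)
  refine gs_abstract M isClosed_setOfPred_isCompactOperator R C hC0 ?_ ?_ hK hquot
  · intro n T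
    change ‖T.comp (P n)‖ ≤ _
    rw [mul_comm]
    exact (T.opNorm_comp_le (P n)).trans (mul_le_mul_of_nonneg_left (hC n) (norm_nonneg _))
  · intro T
    have h := gs_compact hrefl f hf P C hC hfP (T : X →L[𝕜] Y) T.2
    exact h
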